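/- For every natural number n, the number of triples (x,y,z) ∈ ℤ³ with n = x(x+1)/2 + y² + z² is greater than or equal to the number of triples (x,y,z) ∈ ℤ³ with n = x(x+1)/2 + 3y² + 3z². -/

import Mathlib

open PowerSeries

def Adm {α : Type} (e : α → ℤ) : Prop := (∀ a, 0 ≤ e a) ∧ ∀ m : ℤ, Finite {a // e a = m}

noncomputable def GF {α : Type} (e : α → ℤ) : ℤ⟦X⟧ :=
  PowerSeries.mk fun m => (Nat.card {a // e a = (m : ℤ)} : ℤ)

lemma GF_coeff {α : Type} (e : α → ℤ) (m : ℕ) :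
    coeff m (GF e) = (Nat.card {a // e a = (m : ℤ)} : ℤ) := by
  simp [GF]

lemma GF_bij {α β : Type} {e : α → ℤ} {f : β → ℤ} (g : α → β) (hg : Function.Bijective g)
    (h : ∀ a, f (g a) = e a) : GF e = GF f := by
  ext m
  rw [GF_coeff, GF_coeff]
  congr 1
  apply Nat.card_congr
  refine (Equiv.ofBijective g hg).subtypeEquiv ?_
  intro a
  simp [h]

lemma Adm.bij {α β : Type} {e : α → ℤ} {f : β → ℤ} (he : Adm e) (g : β → α)
    (hg : Function.Injective g) (h : ∀ a, e (g a) = f a) : Adm f := by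
  refine ⟨fun a => h a ▸ he.1 _, fun m => ?_⟩
  have := he.2 m
  refine Finite.of_injective (fun a : {a // f a = m} => (⟨g a.1, by rw [h, a.2]⟩ : {a // e a = m})) ?_
  rintro ⟨a, ha⟩ ⟨b, hb⟩ hab
  simp at hab
  simpa using hg hab

/-- splitting of the fibre of a sum -/
noncomputable def fibEquiv {α β : Type} {e : α → ℤ} {f : β → ℤ} (he : Adm e) (hf : Adm f) (m : ℕ) :
    {p : α × β // e p.1 + f p.2 = (m : ℤ)} ≃
      (Σ ij : Finset.HasAntidiagonal.antidiagonal m, {a // e a = (ij.1.1 : ℤ)} × {b // f b = (ij.1.2 : ℤ)}) where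
  toFun p := ⟨⟨((e p.1.1).toNat, (f p.1.2).toNat), by
      have := p.2; have := he.1 p.1.1; have := hf.1 p.1.2
      rw [Finset.HasAntidiagonal.mem_antidiagonal]; simp only; omega⟩,
      ⟨p.1.1, by simp [he.1]⟩, ⟨p.1.2, by simp [hf.1]⟩⟩
  invFun s := ⟨(s.2.1.1, s.2.2.1), by
      have := s.2.1.2; have := s.2.2.2
      have h := s.1.2
      rw [Finset.HasAntidiagonal.mem_antidiagonal] at h
      simp only [s.2.1.2, s.2.2.2]
      exact_mod_cast h⟩
  left_inv p := by simp
  right_inv s := by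
    obtain ⟨⟨⟨i, j⟩, hij⟩, ⟨a, ha⟩, ⟨b, hb⟩⟩ := s
    simp only at ha hb
    have h1 : (e a).toNat = i := by omega
    have h2 : (f b).toNat = j := by omega
    subst h1 h2
    rfl

lemma GF_mul {α β : Type} {e : α → ℤ} {f : β → ℤ} (he : Adm e) (hf : Adm f) :
    GF (fun p : α × β => e p.1 + f p.2) = GF e * GF f := by
  ext m
  rw [GF_coeff, coeff_mul, Nat.card_congr (fibEquiv he hf m)]
  have h1 := he.2
  have h2 := hf.2
  rw [Nat.card_sigma]
  simp only [Nat.card_prod, GF_coeff]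
  push_cast
  exact Finset.sum_coe_sort (Finset.HasAntidiagonal.antidiagonal m) (fun ij => (Nat.card {a // e a = (ij.1 : ℤ)} : ℤ) * (Nat.card {b // f b = (ij.2 : ℤ)} : ℤ))

lemma Adm.mul {α β : Type} {e : α → ℤ} {f : β → ℤ} (he : Adm e) (hf : Adm f) :
    Adm (fun p : α × β => e p.1 + f p.2) := by
  refine ⟨fun p => add_nonneg (he.1 _) (hf.1 _), fun m => ?_⟩
  have h1 := he.2
  have h2 := hf.2
  by_cases hm : 0 ≤ m
  · lift m to ℕ using hm
    exact Finite.of_equiv _ (fibEquiv he hf m).symm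
  · have : IsEmpty {p : α × β // e p.1 + f p.2 = m} := by
      constructor
      rintro ⟨p, hp⟩
      have := he.1 p.1; have := hf.1 p.2
      omega
    infer_instance

lemma GF_add {α β : Type} {e : α → ℤ} {f : β → ℤ} (he : Adm e) (hf : Adm f) :
    GF (Sum.elim e f) = GF e + GF f := by
  ext m
  have h1 := he.2
  have h2 := hf.2
  rw [GF_coeff, map_add, GF_coeff, GF_coeff, ← Nat.cast_add, ← Nat.card_sum]
  congr 1
  exact Nat.card_congr (Equiv.subtypeSum)

lemma Adm_const (ι : Type) [Finite ι] (c : ℕ) : Adm (fun _ : ι => (c : ℤ)) :=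
  ⟨fun _ => by positivity, fun m => inferInstance⟩

lemma GF_const (ι : Type) [Fintype ι] (c : ℕ) :
    GF (fun _ : ι => (c : ℤ)) = (Fintype.card ι : ℤ⟦X⟧) * X ^ c := by
  ext m
  rw [GF_coeff, ← nsmul_eq_mul, map_nsmul, coeff_X_pow]
  by_cases h : m = c
  · subst h
    simp
  · have : IsEmpty {a : ι // (c : ℤ) = m} := ⟨fun x => h (by have := x.2; omega)⟩
    rw [Nat.card_of_isEmpty]
    simp [h]

/-- multiple copies, shifted -/
lemma GF_copies (ι : Type) [Fintype ι] (c : ℕ) {α : Type} {e : α → ℤ} (he : Adm e) :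
    GF (fun p : ι × α => c + e p.2) = (Fintype.card ι : ℤ⟦X⟧) * X ^ c * GF e := by
  rw [← GF_const, ← GF_mul (Adm_const ι c) he]

lemma Adm.copies (ι : Type) [Finite ι] (c : ℕ) {α : Type} {e : α → ℤ} (he : Adm e) :
    Adm (fun p : ι × α => c + e p.2) := (Adm_const ι c).mul he

lemma GF_expand {α : Type} {e : α → ℤ} :
    GF (fun a => 3 * e a) = expand 3 (by norm_num) (GF e) := by
  ext m
  rw [coeff_expand]
  split_ifs with h
  · obtain ⟨k, rfl⟩ := h
    rw [GF_coeff, GF_coeff]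
    congr 1
    apply Nat.card_congr
    refine Equiv.subtypeEquivRight ?_
    intro a
    rw [Nat.mul_div_cancel_left _ (by norm_num)]
    push_cast
    omega
  · rw [GF_coeff]
    have : IsEmpty {a // 3 * e a = (m : ℤ)} := ⟨fun x => h (by have := x.2; omega)⟩
    simp

lemma Adm_of_bound {e : ℤ → ℤ} (h0 : ∀ k, 0 ≤ e k) (h : ∀ k, |k| ≤ e k + 1) : Adm e := by
  refine ⟨h0, fun m => ?_⟩
  apply Set.Finite.subset (Set.finite_Icc (-(m+1)) (m+1))
  intro k hk
  have := h k
  rw [abs_le] at this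
  change e k = m at hk
  rw [hk] at this
  exact this

abbrev eφ : ℤ → ℤ := fun x => 2 * x ^ 2
abbrev eΦ : ℤ → ℤ := fun x => 6 * x ^ 2
abbrev et : ℤ → ℤ := fun x => x * (x + 1)
abbrev es : ℤ → ℤ := fun x => 3 * (x * (x + 1))
abbrev eS : ℤ → ℤ := fun x => 6 * (x * (x + 1))
abbrev ep : ℤ → ℤ := fun x => x * (3 * x + 1)
abbrev eP : ℤ → ℤ := fun x => 2 * (x * (3 * x + 1))
abbrev eb : ℤ → ℤ := fun x => 6 * x ^ 2 + 4 * x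

lemma key1 (k : ℤ) : 0 ≤ k * (k + 1) := by
  rcases le_or_gt 0 k with h | h
  · positivity
  · nlinarith
lemma key2 (k : ℤ) : |k| ≤ k * (k + 1) + 1 := by
  rw [abs_le]; constructor <;> nlinarith [sq_nonneg (k), sq_nonneg (k+1), key1 k]
lemma key3 (k : ℤ) : |k| ≤ k ^ 2 := by
  rw [← sq_abs]; have := key1 (|k| - 1); nlinarith

lemma aφ : Adm eφ := Adm_of_bound (fun k => by positivity) (fun k => by have := key3 k; have := sq_nonneg k; simp only [eφ]; omega)
lemma aΦ : Adm eΦ := Adm_of_bound (fun k => by positivity) (fun k => by have := key3 k; have := sq_nonneg k; simp only [eΦ]; omega)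
lemma at' : Adm et := Adm_of_bound (fun k => key1 k) (fun k => key2 k)
lemma as : Adm es := Adm_of_bound (fun k => by have := key1 k; simp only [es]; omega) (fun k => by have := key1 k; have := key2 k; simp only [es]; omega)
lemma aS : Adm eS := Adm_of_bound (fun k => by have := key1 k; simp only [eS]; omega) (fun k => by have := key1 k; have := key2 k; simp only [eS]; omega)
lemma kp (k : ℤ) : |k| ≤ k * (3 * k + 1) := by
  have := key3 k; have := neg_abs_le k; nlinarith
lemma kb (k : ℤ) : |k| ≤ 6 * k ^ 2 + 4 * k := by
  have := key3 k; have := neg_abs_le k; nlinarith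
lemma ap : Adm ep := Adm_of_bound (fun k => by have := kp k; have := abs_nonneg k; simp only [ep]; omega) (fun k => by have := kp k; simp only [ep]; omega)
lemma aP : Adm eP := Adm_of_bound (fun k => by have := kp k; have := abs_nonneg k; simp only [eP]; omega) (fun k => by have := kp k; have := abs_nonneg k; simp only [eP]; omega)
lemma ab : Adm eb := Adm_of_bound (fun k => by have := kb k; have := abs_nonneg k; simp only [eb]; omega) (fun k => by have := kb k; simp only [eb]; omega)

lemma rel1 : GF ep * GF ep = GF eP * GF eΦ + X ^ 2 * (GF eb * GF eS) := by
  have h := GF_copies Unit 2 (ab.mul aS)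
  simp only [Fintype.card_unit, Nat.cast_one, one_mul] at h
  rw [← GF_mul ap ap, ← GF_mul aP aΦ, ← GF_mul ab aS, ← h, ← GF_add (aP.mul aΦ) ((ab.mul aS).copies Unit 2)]
  symm
  apply GF_bij (Sum.elim (fun q => (q.1 + q.2, q.1 - q.2)) (fun q => (-q.2.1 + q.2.2, -q.2.1 - 1 - q.2.2)))
  · constructor
    · rintro (⟨a, b⟩ | ⟨⟨⟩, a, b⟩) (⟨c, d⟩ | ⟨⟨⟩, c, d⟩) h <;> simp at h ⊢ <;> omega
    · rintro ⟨a, b⟩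
      rcases Int.even_or_odd' (a + b) with ⟨j, hj | hj⟩
      · exact ⟨Sum.inl (j, a - j), by simp; omega⟩
      · exact ⟨Sum.inr ((), (-j - 1, a - j - 1)), by simp; omega⟩
  · rintro (⟨a, b⟩ | ⟨⟨⟩, a, b⟩) <;> simp [ep, eP, eΦ, eb, eS] <;> ring

lemma rel2 : GF ep * GF es = 2 * (GF eP * GF eb) := by
  rw [← GF_mul ap as, ← GF_mul aP ab, two_mul, ← GF_add (aP.mul ab) (aP.mul ab)]
  symm
  apply GF_bij (Sum.elim (fun q => (q.2 - q.1, q.2 + q.1)) (fun q => (-q.1 + q.2, -q.1 - 1 - q.2)))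
  · constructor
    · rintro (⟨a, b⟩ | ⟨a, b⟩) (⟨c, d⟩ | ⟨c, d⟩) h <;> simp at h ⊢ <;> omega
    · rintro ⟨a, b⟩
      rcases Int.even_or_odd' (a + b) with ⟨j, hj | hj⟩
      · exact ⟨Sum.inl (b - j, j), by simp; omega⟩
      · exact ⟨Sum.inr (-j - 1, a - j - 1), by simp; omega⟩
  · rintro (⟨a, b⟩ | ⟨a, b⟩) <;> simp [ep, eP, es, eb] <;> ring

lemma rel3 : GF es * GF es = 2 * (GF eS * GF eΦ) := by
  rw [← GF_mul as as, ← GF_mul aS aΦ, two_mul, ← GF_add (aS.mul aΦ) (aS.mul aΦ)]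
  symm
  apply GF_bij (Sum.elim (fun q => (q.1 + q.2, q.1 - q.2)) (fun q => (q.2 + q.1, q.2 - 1 - q.1)))
  · constructor
    · rintro (⟨a, b⟩ | ⟨a, b⟩) (⟨c, d⟩ | ⟨c, d⟩) h <;> simp at h ⊢ <;> omega
    · rintro ⟨a, b⟩
      rcases Int.even_or_odd' (a + b) with ⟨j, hj | hj⟩
      · exact ⟨Sum.inl (j, a - j), by simp; omega⟩
      · exact ⟨Sum.inr (a - j - 1, j + 1), by simp; omega⟩
  · rintro (⟨a, b⟩ | ⟨a, b⟩) <;> simp [es, eS, eΦ] <;> ring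

abbrev Z4 := (ℤ × ℤ) × (ℤ × ℤ)

def sg : Bool → ℤ
  | true => 1
  | false => -1

def mapT : Fin 4 → ℤ → ℤ → ℤ → ℤ → Z4
  | 0, t0, t1, t2, t3 => ((t1+t2+t3+1, t2-t1-t0), (t3-t1+t0, t2-t3+t0))
  | 1, t0, t1, t2, t3 => ((t2-t1+t0, t2+t1+t3+1), (t0+t1-t3, t2-t0-t3))
  | 2, t0, t1, t2, t3 => ((t2-t1+t0, t0+t1-t3), (t2+t1+t3+1, t0-t2+t3))
  | 3, t0, t1, t2, t3 => ((t0+t1-t2, t1-t0-t3), (-t2-t0+t3, t1+t2+t3+1))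

def fullT : Z4 ⊕ ((Bool × Fin 4) × Z4) → Z4 :=
  Sum.elim (fun w => ((w.1.1+w.1.2+w.2.1, w.1.2-w.1.1-w.2.2), (w.2.1-w.1.1+w.2.2, w.1.2-w.2.1+w.2.2)))
    (fun q => match q with
      | ((true, i), t) => mapT i t.1.1 t.1.2 t.2.1 t.2.2
      | ((false, i), t) => -mapT i t.1.1 t.1.2 t.2.1 t.2.2)

lemma fullT_inj : Function.Injective fullT := by
  rintro (⟨⟨a, b⟩, ⟨c, d⟩⟩ | ⟨⟨u, i⟩, ⟨⟨a, b⟩, ⟨c, d⟩⟩⟩) (⟨⟨a', b'⟩, ⟨c', d'⟩⟩ | ⟨⟨u', i'⟩, ⟨⟨a', b'⟩, ⟨c', d'⟩⟩⟩) h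
  · simp [fullT] at h ⊢; omega
  · exfalso
    cases u' <;> fin_cases i' <;> simp [fullT, mapT] at h <;> omega
  · exfalso
    cases u <;> fin_cases i <;> simp [fullT, mapT] at h <;> omega
  · cases u <;> fin_cases i <;> cases u' <;> fin_cases i' <;> simp [fullT, mapT] at h ⊢ <;> omega

lemma fullT_surj : Function.Surjective fullT := by
  rintro ⟨⟨a, b⟩, ⟨c, d⟩⟩
  -- w = π x
  obtain ⟨w0, hw0⟩ : ∃ w, w = a - b - c := ⟨_, rfl⟩
  obtain ⟨w1, hw1⟩ : ∃ w, w = a + b + d := ⟨_, rfl⟩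
  obtain ⟨w2, hw2⟩ : ∃ w, w = a + c - d := ⟨_, rfl⟩
  obtain ⟨w3, hw3⟩ : ∃ w, w = d + c - b := ⟨_, rfl⟩
  have h0 : w0 % 3 = 0 ∨ w0 % 3 = 1 ∨ w0 % 3 = 2 := by omega
  have h1 : w1 % 3 = 0 ∨ w1 % 3 = 1 ∨ w1 % 3 = 2 := by omega
  rcases h0 with h0 | h0 | h0 <;> rcases h1 with h1 | h1 | h1
  · exact ⟨Sum.inl ((w0 / 3, w1 / 3), (w2 / 3, w3 / 3)), by simp [fullT]; omega⟩
  · exact ⟨Sum.inr ((true, 3), ((w0 / 3, w1 / 3), ((-w2) / 3, w3 / 3))), by simp [fullT, mapT]; omega⟩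
  · exact ⟨Sum.inr ((false, 3), (((-w0) / 3, (-w1) / 3), ((w2) / 3, (-w3) / 3))), by simp [fullT, mapT]; omega⟩
  · exact ⟨Sum.inr ((false, 2), (((-w1) / 3, (w0) / 3), ((-w2) / 3, (-w3) / 3))), by simp [fullT, mapT]; omega⟩
  · exact ⟨Sum.inr ((true, 0), (((w3) / 3, (w0) / 3), ((w1) / 3, (w2) / 3))), by simp [fullT, mapT]; omega⟩
  · exact ⟨Sum.inr ((false, 1), (((-w2) / 3, (w0) / 3), ((-w1) / 3, (w3) / 3))), by simp [fullT, mapT]; omega⟩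
  · exact ⟨Sum.inr ((true, 2), (((w1) / 3, (-w0) / 3), ((w2) / 3, (w3) / 3))), by simp [fullT, mapT]; omega⟩
  · exact ⟨Sum.inr ((true, 1), (((w2) / 3, (-w0) / 3), ((w1) / 3, (-w3) / 3))), by simp [fullT, mapT]; omega⟩
  · exact ⟨Sum.inr ((false, 0), (((-w3) / 3, (-w0) / 3), ((-w1) / 3, (-w2) / 3))), by simp [fullT, mapT]; omega⟩

lemma relT : GF eφ ^ 4 = GF eΦ ^ 4 + 8 * X ^ 2 * (GF eΦ * GF eb ^ 3) := by
  have h := GF_copies (Bool × Fin 4) 2 ((aΦ.mul ab).mul (ab.mul ab))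
  have hc : ((Fintype.card (Bool × Fin 4) : ℕ) : ℤ⟦X⟧) = 8 := by norm_num
  rw [hc, GF_mul (aΦ.mul ab) (ab.mul ab), GF_mul aΦ ab, GF_mul ab ab] at h
  have e1 : GF eφ ^ 4 = (GF eφ * GF eφ) * (GF eφ * GF eφ) := by ring
  have e2 : GF eΦ ^ 4 = (GF eΦ * GF eΦ) * (GF eΦ * GF eΦ) := by ring
  have e3 : GF eΦ * GF eb ^ 3 = (GF eΦ * GF eb) * (GF eb * GF eb) := by ring
  rw [e1, e2, e3, ← h, ← GF_mul aφ aφ, ← GF_mul (aφ.mul aφ) (aφ.mul aφ), ← GF_mul aΦ aΦ,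
    ← GF_mul (aΦ.mul aΦ) (aΦ.mul aΦ), ← GF_add ((aΦ.mul aΦ).mul (aΦ.mul aΦ)) (((aΦ.mul ab).mul (ab.mul ab)).copies _ 2)]
  symm
  apply GF_bij fullT ⟨fullT_inj, fullT_surj⟩
  rintro (⟨⟨a, b⟩, ⟨c, d⟩⟩ | ⟨⟨u, i⟩, ⟨⟨a, b⟩, ⟨c, d⟩⟩⟩)
  · simp [fullT, eφ, eΦ]; ring
  · cases u <;> fin_cases i <;> simp [fullT, mapT, eφ, eΦ, eb] <;> ring

lemma const_one {e : ℤ → ℤ} (h : ∀ k, e k = 0 ↔ k = 0) : constantCoeff (GF e) = 1 := by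
  rw [← coeff_zero_eq_constantCoeff_apply, GF_coeff]
  simp [h]

lemma const_s : constantCoeff (GF es) = 2 := by
  rw [← coeff_zero_eq_constantCoeff_apply, GF_coeff]
  have : ∀ a : ℤ, (es a = ((0:ℕ):ℤ)) ↔ a ∈ ({0, -1} : Finset ℤ) := by
    intro a
    simp [es]
    omega
  simp only [this]
  rw [Nat.card_eq_fintype_card, Fintype.card_coe]
  rfl

lemma relE : GF es * GF eφ ^ 2 = 4 * GF eb * GF ep * GF eΦ - GF es * GF eΦ ^ 2 := by
  have h1 := rel1
  have h2 := rel2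
  have h3 := rel3
  have h4 := relT
  have cs := const_s
  have cφ : constantCoeff (GF eφ) = 1 := const_one (fun k => by simp [eφ])
  have cΦ : constantCoeff (GF eΦ) = 1 := const_one (fun k => by simp [eΦ])
  have cb : constantCoeff (GF eb) = 1 := const_one (fun k => ⟨fun h => by
    have := kb k; simp only [eb] at h; rw [h] at this; exact abs_nonpos_iff.mp this, fun h => by simp [h, eb]⟩)
  have cp : constantCoeff (GF ep) = 1 := const_one (fun k => ⟨fun h => by
    have := kp k; simp only [ep] at h; rw [h] at this; exact abs_nonpos_iff.mp this, fun h => by simp [h, ep]⟩)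
  generalize GF eφ = φ at *
  generalize GF eΦ = Φ at *
  generalize GF eb = b at *
  generalize GF ep = p at *
  generalize GF es = s at *
  generalize GF eP = P at *
  generalize GF eS = S at *
  have hG : 2 * b * Φ * p ^ 2 = p * s * Φ ^ 2 + X ^ 2 * b ^ 2 * s ^ 2 := by
    linear_combination 2 * b * Φ * h1 - Φ ^ 2 * h2 - X ^ 2 * b ^ 2 * h3
  have hsq : (s * φ ^ 2) ^ 2 = (4 * b * p * Φ - s * Φ ^ 2) ^ 2 := by
    linear_combination s ^ 2 * h4 - 8 * b * Φ * hG
  rcases sq_eq_sq_iff_eq_or_eq_neg.mp hsq with h | h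
  · exact h
  · exfalso
    have := congrArg constantCoeff h
    simp [cs, cφ, cΦ, cb, cp] at this
    have h4 : constantCoeff (4 : ℤ⟦X⟧) = 4 := map_ofNat _ 4
    rw [h4] at this
    norm_num at this

lemma relE' : GF ep * GF eφ ^ 2 = GF ep * GF eΦ ^ 2 + 2 * X ^ 2 * GF es * GF eb ^ 2 := by
  have h1 := rel1
  have h2 := rel2
  have h3 := rel3
  have hE := relE
  have hs : GF es ≠ 0 := by
    intro h
    have := const_s
    simp [h] at this
  generalize GF eφ = φ at *
  generalize GF eΦ = Φ at *
  generalize GF eb = b at *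
  generalize GF ep = p at *
  generalize GF es = s at *
  generalize GF eP = P at *
  generalize GF eS = S at *
  have hG : 2 * b * Φ * p ^ 2 = p * s * Φ ^ 2 + X ^ 2 * b ^ 2 * s ^ 2 := by
    linear_combination 2 * b * Φ * h1 - Φ ^ 2 * h2 - X ^ 2 * b ^ 2 * h3
  apply mul_left_cancel₀ hs
  linear_combination p * hE + 2 * hG

lemma dis_t : GF et = 2 * expand 3 (by norm_num) (GF ep) + X ^ 2 * expand 3 (by norm_num) (GF es) := by
  have a3p : Adm (fun a => 3 * ep a) := Adm_of_bound (fun k => by have := ap.1 k; omega) (fun k => by have := kp k; have := ap.1 k; simp only [ep] at *; omega)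
  have a3s : Adm (fun a => 3 * es a) := Adm_of_bound (fun k => by have := as.1 k; omega) (fun k => by have := key2 k; have := key1 k; simp only [es] at *; omega)
  have h := GF_copies Unit 2 a3s
  simp only [Fintype.card_unit, Nat.cast_one, one_mul] at h
  rw [← GF_expand, ← GF_expand, ← h, two_mul, ← GF_add a3p a3p,
    ← GF_add (e := Sum.elim _ _) ⟨by rintro (a | a) <;> exact a3p.1 a, fun m => by
      have h5 := a3p.2 m
      have h6 : Finite ({ a // Sum.elim (fun a => 3 * ep a) (fun a => 3 * ep a) (Sum.inl a) = m } ⊕ { b // Sum.elim (fun a => 3 * ep a) (fun a => 3 * ep a) (Sum.inr b) = m }) := @Finite.instSum _ _ h5 h5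
      exact Finite.of_equiv _ (Equiv.subtypeSum (p := fun c => Sum.elim (fun a => 3 * ep a) (fun a => 3 * ep a) c = m)).symm⟩ (a3s.copies Unit 2)]
  symm
  apply GF_bij (Sum.elim (Sum.elim (fun k => 3 * k) (fun k => -3 * k - 1)) (fun q => 3 * q.2 + 1))
  · constructor
    · rintro ((a | a) | ⟨⟨⟩, a⟩) ((b | b) | ⟨⟨⟩, b⟩) h <;> simp at h ⊢ <;> omega
    · intro a
      have : a % 3 = 0 ∨ a % 3 = 1 ∨ a % 3 = 2 := by omega
      rcases this with h | h | h
      · exact ⟨Sum.inl (Sum.inl (a / 3)), by simp; omega⟩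
      · exact ⟨Sum.inr ((), a / 3), by simp; omega⟩
      · exact ⟨Sum.inl (Sum.inr ((-a) / 3)), by simp; omega⟩
  · rintro ((a | a) | ⟨⟨⟩, a⟩) <;> simp [et, ep, es] <;> ring

lemma exp_φ : expand 3 (by norm_num) (GF eφ) = GF eΦ := by
  rw [← GF_expand]
  congr 1
  funext a
  simp only [eφ, eΦ]; ring

lemma dis_φ : GF eφ = expand 3 (by norm_num) (GF eΦ) + 2 * X ^ 2 * expand 3 (by norm_num) (GF eb) := by
  have a3Φ : Adm (fun a => 3 * eΦ a) := Adm_of_bound (fun k => by have := aΦ.1 k; omega) (fun k => by have := key3 k; have := sq_nonneg k; simp only [eΦ] at *; omega)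
  have a3b : Adm (fun a => 3 * eb a) := Adm_of_bound (fun k => by have := ab.1 k; omega) (fun k => by have := kb k; have := ab.1 k; simp only [eb] at *; omega)
  have h := GF_copies Bool 2 a3b
  rw [Fintype.card_bool, show ((2 : ℕ) : ℤ⟦X⟧) = 2 by norm_num] at h
  rw [← GF_expand, ← GF_expand, ← h, ← GF_add a3Φ (a3b.copies Bool 2)]
  symm
  apply GF_bij (Sum.elim (fun k => 3 * k) (fun q => match q with
    | (true, k) => 3 * k + 1
    | (false, k) => -(3 * k + 1)))
  · constructor
    · rintro (a | ⟨_ | _, a⟩) (b | ⟨_ | _, b⟩) h <;> simp at h ⊢ <;> omega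
    · intro a
      have : a % 3 = 0 ∨ a % 3 = 1 ∨ a % 3 = 2 := by omega
      rcases this with h | h | h
      · exact ⟨Sum.inl (a / 3), by simp; omega⟩
      · exact ⟨Sum.inr (true, a / 3), by simp; omega⟩
      · exact ⟨Sum.inr (false, (-a) / 3), by simp; omega⟩
  · rintro (a | ⟨_ | _, a⟩) <;> simp [eφ, eΦ, eb] <;> ring

lemma A_eq : GF et * GF eφ ^ 2 - GF et * GF eΦ ^ 2 =
    X ^ 2 * expand 3 (by norm_num) (2 * (GF es * GF eΦ ^ 2 + 2 * (GF ep * GF eΦ * GF eb)))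
    + X ^ 4 * expand 3 (by norm_num) (8 * (GF ep * GF eb ^ 2) + 4 * (GF es * GF eΦ * GF eb)) := by
  have h1 := congrArg (expand 3 (by norm_num)) relE
  have h2 := congrArg (expand 3 (by norm_num)) relE'
  rw [← exp_φ, dis_t]
  rw [show GF eφ ^ 2 = (expand 3 (by norm_num) (GF eΦ) + 2 * X ^ 2 * expand 3 (by norm_num) (GF eb)) ^ 2 by rw [← dis_φ]]
  simp only [map_add, map_sub, map_mul, map_pow, map_ofNat, expand_X] at h1 h2 ⊢
  rw [exp_φ] at *
  linear_combination -2 * h2 - X ^ 2 * h1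

def NN (f : ℤ⟦X⟧) : Prop := ∀ n, 0 ≤ coeff n f
lemma NN.add {f g} (hf : NN f) (hg : NN g) : NN (f + g) := fun n => by
  rw [map_add]; exact add_nonneg (hf n) (hg n)
lemma NN.mul {f g} (hf : NN f) (hg : NN g) : NN (f * g) := fun n => by
  rw [coeff_mul]; exact Finset.sum_nonneg fun i _ => mul_nonneg (hf _) (hg _)
lemma NN_nat (c : ℕ) : NN (c : ℤ⟦X⟧) := fun n => by
  rw [← map_natCast (C (R := ℤ)), coeff_C]; split_ifs <;> simp
lemma NN_GF {α : Type} (e : α → ℤ) : NN (GF e) := fun n => by rw [GF_coeff]; positivity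
lemma NN_X (c : ℕ) : NN (X ^ c) := fun n => by rw [coeff_X_pow]; split_ifs <;> simp
lemma NN.exp {f} (hf : NN f) : NN (expand 3 (by norm_num) f) := fun n => by
  rw [coeff_expand]; split_ifs
  · exact hf _
  · exact le_rfl

lemma diff_NN : NN (GF et * GF eφ ^ 2 - GF et * GF eΦ ^ 2) := by
  rw [A_eq]
  have n2 : NN (2 : ℤ⟦X⟧) := NN_nat 2
  have n4 : NN (4 : ℤ⟦X⟧) := NN_nat 4
  have n8 : NN (8 : ℤ⟦X⟧) := NN_nat 8
  simp only [pow_two (GF _)]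
  refine ((NN_X 2).mul (NN.exp ?_)).add ((NN_X 4).mul (NN.exp ?_))
  · exact n2.mul (((NN_GF _).mul ((NN_GF _).mul (NN_GF _))).add (n2.mul (((NN_GF _).mul (NN_GF _)).mul (NN_GF _))))
  · exact (n8.mul ((NN_GF _).mul ((NN_GF _).mul (NN_GF _)))).add (n4.mul (((NN_GF _).mul (NN_GF _)).mul (NN_GF _)))

theorem triangular_square_count_ge (n : ℕ) :
    {p : ℤ × ℤ × ℤ | (n : ℤ) = p.1 * (p.1 + 1) / 2 + p.2.1 ^ 2 + p.2.2 ^ 2}.ncard ≥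
    {p : ℤ × ℤ × ℤ | (n : ℤ) = p.1 * (p.1 + 1) / 2 + 3 * p.2.1 ^ 2 + 3 * p.2.2 ^ 2}.ncard := by
  have h := diff_NN (2 * n)
  rw [pow_two, pow_two, ← GF_mul aφ aφ, ← GF_mul at' (aφ.mul aφ), ← GF_mul aΦ aΦ,
    ← GF_mul at' (aΦ.mul aΦ), map_sub, GF_coeff, GF_coeff, sub_nonneg, Nat.cast_le] at h
  rw [ge_iff_le, ← Nat.card_coe_set_eq, ← Nat.card_coe_set_eq]
  convert h using 4
  all_goals
    rename_i p
    obtain ⟨x, y, z⟩ := p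
    have := Int.even_mul_succ_self x
    obtain ⟨r, hr⟩ := this
    simp only [Set.mem_ofPred_eq, et, eφ, eΦ, hr]
    push_cast
    omega
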